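/- In the Fibonacci-run graph R_{91}, the strings α = (111)⁵ 1 0¹⁷ 1¹⁹ 0²⁰ 1¹⁰ 0⁹ and β = (100)⁵ 1 1¹⁷ 0¹⁹ 1²⁰ 0¹⁰ 0⁹ are vertices and d_{R_{91}}(α, β) ≥ 86; consequently diam(R_{91}) ≥ 86 > 91 − ⌊√(1 + 91/2) − 3/4⌋ = 85. -/

import Mathlib

/-- Run-constrained binary strings: every maximal run of `1`s is immediately
followed by a strictly longer run of `0`s. -/
inductive RunConstrained : List Bool → Prop
  | nil : RunConstrained []
  | zero {l : List Bool} : RunConstrained l → RunConstrained (false :: l)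
  | block {l : List Bool} (r s : ℕ) (hr : 1 ≤ r) (hs : r < s) :
      RunConstrained l →
      RunConstrained (List.replicate r true ++ List.replicate s false ++ l)

/-- Hamming distance between two binary strings (of the same length). -/
def hammingD (α β : List Bool) : ℕ := (List.zipWith bne α β).count true

/-- The Fibonacci-run graph `R n`: vertices are strings `r` of length `n` with
`r00` run-constrained; two vertices are adjacent iff they differ in exactly one
coordinate. -/
noncomputable def fibRunGraph (n : ℕ) :
    SimpleGraph {l : List Bool // l.length = n ∧ RunConstrained (l ++ [false, false])} :=
  SimpleGraph.fromRel fun a b => hammingD a.1 b.1 = 1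

/-- `α = (111)⁵ 1 0¹⁷ 1¹⁹ 0²⁰ 1¹⁰ 0⁹`. -/
def alpha91 : List Bool :=
  (List.replicate 5 [true, true, true]).flatten ++ [true] ++ List.replicate 17 false
    ++ List.replicate 19 true ++ List.replicate 20 false ++ List.replicate 10 true
    ++ List.replicate 9 false

/-- `β = (100)⁵ 1 1¹⁷ 0¹⁹ 1²⁰ 0¹⁰ 0⁹`. -/
def beta91 : List Bool :=
  (List.replicate 5 [true, false, false]).flatten ++ [true] ++ List.replicate 17 true
    ++ List.replicate 19 false ++ List.replicate 20 true ++ List.replicate 10 false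
    ++ List.replicate 9 false

theorem hammingD_eq_sum : ∀ {a b : List Bool}, a.length = b.length →
    hammingD a b = ∑ i ∈ Finset.range a.length, if a[i]? = b[i]? then 0 else 1
  | [], [], _ => by simp [hammingD]
  | x :: a, y :: b, h => by
    have ih := hammingD_eq_sum (a := a) (b := b) (by simpa using h)
    simp only [hammingD] at ih
    simp only [hammingD, List.zipWith_cons_cons, List.count_cons, List.length_cons,
      Finset.sum_range_succ', List.getElem?_cons_succ, ih, List.getElem?_cons_zero]
    cases x <;> cases y <;> simp

theorem hammingD_set {a : List Bool} {i : ℕ} (h : a[i]? = some true) :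
    hammingD a (a.set i false) = 1 := by
  obtain ⟨hi, hget⟩ := List.getElem?_eq_some_iff.mp h
  rw [hammingD_eq_sum (by simp), Finset.sum_eq_single_of_mem i (by simpa using hi)]
  · simp [hi, hget]
  · intro j _ hj
    simp [Ne.symm hj]

/-- In a run-constrained string no single `0` separates two `1`s. -/
theorem RunConstrained.not_true_false_true {l : List Bool} (h : RunConstrained l) (i : ℕ)
    (h₀ : l[i]? = some true) (h₁ : l[i + 1]? = some false) (h₂ : l[i + 2]? = some true) :
    False := by
  induction h generalizing i with
  | nil => simp at h₀
  | zero _ ih =>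
    cases i with
    | zero => simp at h₀
    | succ i => exact ih i (by simpa using h₀) (by simpa using h₁) (by simpa using h₂)
  | block r s hr hs _ ih =>
    rw [List.append_assoc] at h₀ h₁ h₂
    simp only [List.getElem?_append, List.length_replicate, List.getElem?_replicate]
      at h₀ h₁ h₂
    by_cases hi : i < r + s
    · grind
    · refine ih (i - r - s) ?_ ?_ ?_
      · grind
      · rw [show i - r - s + 1 = i + 1 - r - s by omega]
        grind
      · rw [show i - r - s + 2 = i + 2 - r - s by omega]
        grind

theorem RunConstrained.replicate_false_append {l : List Bool} (h : RunConstrained l) :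
    ∀ s : ℕ, RunConstrained (List.replicate s false ++ l)
  | 0 => by simpa using h
  | s + 1 => (h.replicate_false_append s).zero

/-- The last `1` of some run of a nonzero run-constrained string can be deleted. -/
theorem RunConstrained.exists_set_false {l : List Bool} (h : RunConstrained l)
    (ht : true ∈ l) : ∃ i, l[i]? = some true ∧ RunConstrained (l.set i false) := by
  induction h with
  | nil => simp at ht
  | zero _ ih =>
    obtain ⟨i, hi, hi'⟩ := ih (by simpa using ht)
    exact ⟨i + 1, by simpa using hi, by simpa using hi'.zero⟩
  | @block l r s hr hs hl _ =>
    obtain ⟨r, rfl⟩ : ∃ k, r = k + 1 := ⟨r - 1, by omega⟩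
    refine ⟨r, by simp [List.getElem?_append], ?_⟩
    have heq : (List.replicate (r + 1) true ++ List.replicate s false ++ l).set r false =
        List.replicate r true ++ List.replicate (s + 1) false ++ l := by
      rw [List.append_assoc, List.replicate_succ', List.append_assoc,
        List.set_append_right _ _ (by simp)]
      simp [List.replicate_succ]
    rw [heq]
    rcases Nat.eq_zero_or_pos r with rfl | hr'
    · simpa using hl.replicate_false_append (s + 1)
    · exact hl.block r (s + 1) hr' (by omega)

section Graph

variable {n : ℕ}

abbrev FibRunVertex (n : ℕ) : Type :=
  {l : List Bool // l.length = n ∧ RunConstrained (l ++ [false, false])}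

instance : Finite (FibRunVertex n) :=
  ((List.finite_length_eq Bool n).subset fun _ h => h.1).to_subtype

theorem fibRunGraph_sum_of_adj {u v : FibRunVertex n} (h : (fibRunGraph n).Adj u v) :
    ∑ i ∈ Finset.range n, (if u.1[i]? = v.1[i]? then 0 else 1) = 1 := by
  rw [fibRunGraph, SimpleGraph.fromRel_adj] at h
  rcases h.2 with h | h
  · rwa [hammingD_eq_sum (u.2.1.trans v.2.1.symm), u.2.1] at h
  · rw [hammingD_eq_sum (v.2.1.trans u.2.1.symm), v.2.1] at h
    simpa only [eq_comm] using h

theorem fibRunGraph_getElem?_eq_of_adj {u v : FibRunVertex n} (h : (fibRunGraph n).Adj u v)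
    {i j : ℕ} (hi : i < n) (hj : j < n) (hij : i ≠ j) (hne : u.1[i]? ≠ v.1[i]?) :
    u.1[j]? = v.1[j]? := by
  by_contra hne'
  have hle := Finset.sum_le_sum_of_subset (f := fun k => if u.1[k]? = v.1[k]? then 0 else 1)
    (show ({i, j} : Finset ℕ) ⊆ Finset.range n by
      simp [Finset.insert_subset_iff, hi, hj])
  rw [fibRunGraph_sum_of_adj h, Finset.sum_pair hij] at hle
  simp [hne, hne'] at hle

theorem fibRunGraph_reachable_zero (u z : FibRunVertex n) (hz : true ∉ z.1) :
    (fibRunGraph n).Reachable u z := by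
  induction hk : u.1.count true using Nat.strong_induction_on generalizing u with
  | _ k ih =>
    by_cases ht : true ∈ u.1
    · obtain ⟨i, hi, hrc⟩ := u.2.2.exists_set_false (by simp [ht])
      have hlt : i < u.1.length := by
        by_contra hge
        rw [List.getElem?_append_right (by omega)] at hi
        have := List.mem_of_getElem? hi
        simp at this
      rw [List.getElem?_append_left hlt] at hi
      rw [List.set_append_left _ _ hlt] at hrc
      have hget : u.1[i] = true := by simpa [hlt] using hi
      let w : FibRunVertex n := ⟨u.1.set i false, by simpa using u.2.1, hrc⟩
      have hham : hammingD u.1 w.1 = 1 := hammingD_set hi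
      have hadj : (fibRunGraph n).Adj u w := by
        refine (SimpleGraph.fromRel_adj _ _ _).mpr ⟨fun h => ?_, Or.inl hham⟩
        have h' : u.1[i]? = w.1[i]? := by rw [← h]
        simp [w, hlt, hget] at h'
      refine hadj.reachable.trans (ih _ ?_ w rfl)
      have := List.count_pos_iff.mpr ht
      simp only [w, List.count_set hlt, hget]
      simp
      omega
    · have : u = z := by
        apply Subtype.ext
        have h1 : u.1 = List.replicate n false :=
          List.eq_replicate_iff.mpr ⟨u.2.1, fun b hb => by cases b <;> simp_all⟩
        have h2 : z.1 = List.replicate n false :=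
          List.eq_replicate_iff.mpr ⟨z.2.1, fun b hb => by cases b <;> simp_all⟩
        rw [h1, h2]
      rw [this]

theorem fibRunGraph_connected (n : ℕ) : (fibRunGraph n).Connected := by
  let z : FibRunVertex n := ⟨List.replicate n false, by simp, by
    simpa using (RunConstrained.nil.replicate_false_append 2).replicate_false_append n⟩
  have hz : true ∉ z.1 := by simp [z]
  have : Nonempty (FibRunVertex n) := ⟨z⟩
  exact ⟨fun u v => (fibRunGraph_reachable_zero u z hz).trans
    (fibRunGraph_reachable_zero v z hz).symm⟩

/-- The number of steps of a walk that flip coordinate `i`. -/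
def flips (i : ℕ) {u v : FibRunVertex n} : (fibRunGraph n).Walk u v → ℕ
  | .nil => 0
  | .cons (v := w) _ p => (if u.1[i]? = w.1[i]? then 0 else 1) + flips i p

theorem sum_flips {u v : FibRunVertex n} (p : (fibRunGraph n).Walk u v) :
    ∑ i ∈ Finset.range n, flips i p = p.length := by
  induction p with
  | nil => simp [flips]
  | cons h p ih =>
    simp only [flips, Finset.sum_add_distrib, ih, fibRunGraph_sum_of_adj h,
      SimpleGraph.Walk.length_cons]
    omega

theorem one_le_flips {u v : FibRunVertex n} (p : (fibRunGraph n).Walk u v) {i : ℕ}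
    (h : u.1[i]? ≠ v.1[i]?) : 1 ≤ flips i p := by
  induction p with
  | nil => exact absurd rfl h
  | cons _ p ih =>
    simp only [flips]
    split_ifs with heq
    · exact (ih (heq ▸ h)).trans (by omega)
    · omega

theorem two_le_flips {u v w : FibRunVertex n} (p : (fibRunGraph n).Walk u v) {i : ℕ}
    (hw : w ∈ p.support) (hu : u.1[i]? ≠ w.1[i]?) (hv : w.1[i]? ≠ v.1[i]?)
    (huv : u.1[i]? = v.1[i]?) : 2 ≤ flips i p := by
  induction p with
  | nil =>
    simp only [SimpleGraph.Walk.support_nil, List.mem_singleton] at hw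
    exact absurd (hw ▸ rfl) hv
  | cons _ p ih =>
    rw [SimpleGraph.Walk.support_cons, List.mem_cons] at hw
    rcases hw with rfl | hw
    · exact absurd rfl hu
    simp only [flips]
    split_ifs with heq
    · exact (ih hw (heq ▸ hu) hv (heq ▸ huv)).trans (by omega)
    · have := one_le_flips p (i := i) (fun h => heq (huv.trans h.symm))
      omega

/-- A block of `1`s persists along a walk that never changes its two end bits. -/
theorem block_persists {u v : FibRunVertex n} (p : (fibRunGraph n).Walk u v) {a b : ℕ}
    (hb : b < n) (hu : ∀ j, a ≤ j → j ≤ b → u.1[j]? = some true)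
    (ha' : ∀ w ∈ p.support, w.1[a]? = some true)
    (hb' : ∀ w ∈ p.support, w.1[b]? = some true) :
    ∀ j, a ≤ j → j ≤ b → v.1[j]? = some true := by
  induction p with
  | nil => exact hu
  | @cons u w v hadj p ih =>
    refine ih (fun j hj₁ hj₂ => ?_) (fun x hx => ha' x (by simp [hx]))
      (fun x hx => hb' x (by simp [hx]))
    by_contra hne
    have hja : j ≠ a := by
      rintro rfl
      exact hne (ha' w (by simp))
    have hjb : j ≠ b := by
      rintro rfl
      exact hne (hb' w (by simp))
    have hlen : w.1.length = n := w.2.1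
    have hflip : u.1[j]? ≠ w.1[j]? := fun h => hne (h ▸ hu j hj₁ hj₂)
    have hleft : w.1[j - 1]? = some true := by
      rw [← fibRunGraph_getElem?_eq_of_adj hadj (by omega) (by omega)
        (show j ≠ j - 1 by omega) hflip]
      exact hu _ (by omega) (by omega)
    have hright : w.1[j + 1]? = some true := by
      rw [← fibRunGraph_getElem?_eq_of_adj hadj (by omega) (by omega)
        (show j ≠ j + 1 by omega) hflip]
      exact hu _ (by omega) (by omega)
    have hmid : w.1[j]? = some false := by
      rw [List.getElem?_eq_getElem (by omega)] at hne ⊢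
      simpa using hne
    obtain ⟨k, rfl⟩ : ∃ k, j = k + 1 := ⟨j - 1, by omega⟩
    refine w.2.2.not_true_false_true k ?_ ?_ ?_
    · rw [List.getElem?_append_left (by omega)]
      simpa using hleft
    · rw [List.getElem?_append_left (by omega)]
      exact hmid
    · rw [List.getElem?_append_left (by omega)]
      exact hright

end Graph

theorem alpha91_vertex : alpha91.length = 91 ∧ RunConstrained (alpha91 ++ [false, false]) :=
  ⟨by decide, RunConstrained.nil.block 10 11 (by decide) (by decide)
    |>.block 19 20 (by decide) (by decide) |>.block 16 17 (by decide) (by decide)⟩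

theorem beta91_vertex : beta91.length = 91 ∧ RunConstrained (beta91 ++ [false, false]) :=
  ⟨by decide, RunConstrained.nil.block 20 21 (by decide) (by decide)
    |>.block 18 19 (by decide) (by decide) |>.block 1 2 (by decide) (by decide)
    |>.block 1 2 (by decide) (by decide) |>.block 1 2 (by decide) (by decide)
    |>.block 1 2 (by decide) (by decide) |>.block 1 2 (by decide) (by decide)⟩

theorem alpha91_beta91_walk_length
    (p : (fibRunGraph 91).Walk ⟨alpha91, alpha91_vertex⟩ ⟨beta91, beta91_vertex⟩) :
    86 ≤ p.length := by
  have hα : ∀ j ≤ 15, alpha91[j]? = some true := by decide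
  have hβ : ∀ k ≤ 5, beta91[3 * k]? = some true := by decide
  have hβ' : ∀ k < 5, beta91[3 * k + 1]? ≠ some true := by decide
  have hpair : ∀ a b : ℕ, a < b → b ≤ 5 →
      2 ≤ flips (3 * a) p ∨ 2 ≤ flips (3 * b) p := by
    intro a b hab hb
    have htwo : ∀ k ≤ 5, ¬ 2 ≤ flips (3 * k) p → ∀ w ∈ p.support,
        w.1[3 * k]? = some true := by
      intro k hk hlt w hw
      by_contra hne
      have hαk := hα (3 * k) (by omega)
      have hβk := hβ k hk
      exact hlt (two_le_flips p hw (fun h => hne (h ▸ hαk)) (fun h => hne (h ▸ hβk))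
        (hαk.trans hβk.symm))
    by_contra! hlt
    exact hβ' a (by omega) (block_persists p (a := 3 * a) (b := 3 * b) (by omega)
      (fun j _ hj => hα j (by omega)) (htwo a (by omega) (by omega))
      (htwo b hb (by omega)) (3 * a + 1) (by omega) (by omega))
  obtain ⟨x, hx, hflips⟩ : ∃ x ≤ 5, ∀ k ≤ 5, k ≠ x → 2 ≤ flips (3 * k) p := by
    by_cases hall : ∀ k ≤ 5, 2 ≤ flips (3 * k) p
    · exact ⟨0, by omega, fun k hk _ => hall k hk⟩
    · push Not at hall
      obtain ⟨x, hx, hlt⟩ := hall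
      refine ⟨x, hx, fun k hk hne => ?_⟩
      rcases lt_or_gt_of_ne hne with h | h
      · exact (hpair k x h hx).resolve_right (by omega)
      · exact (hpair x k h hk).resolve_left (by omega)
  have hcount : ∀ x ≤ 5, ∑ i ∈ Finset.range 91,
      (if alpha91[i]? ≠ beta91[i]? then 1
        else if i % 3 = 0 ∧ i ≤ 15 ∧ i ≠ 3 * x then 2 else 0) = 86 := by
    decide +kernel
  rw [← sum_flips p, ← hcount x hx]
  refine Finset.sum_le_sum fun i _ => ?_
  split_ifs with hne hi
  · exact one_le_flips p hne
  · have := hflips (i / 3) (by omega) (by omega)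
    rwa [show 3 * (i / 3) = i by omega] at this
  · exact Nat.zero_le _

theorem floor_sqrt_bound : ⌊Real.sqrt (1 + (91 : ℝ) / 2) - 3 / 4⌋ = 6 := by
  rw [Int.floor_eq_iff]
  constructor
  · have : (27 / 4 : ℝ) ≤ Real.sqrt (1 + (91 : ℝ) / 2) := Real.le_sqrt_of_sq_le (by norm_num)
    push_cast
    linarith
  · have : Real.sqrt (1 + (91 : ℝ) / 2) < 31 / 4 :=
      (Real.sqrt_lt' (by norm_num)).mpr (by norm_num)
    push_cast
    linarith

theorem stmt_15 :
    ∃ (hα : alpha91.length = 91 ∧ RunConstrained (alpha91 ++ [false, false]))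
      (hβ : beta91.length = 91 ∧ RunConstrained (beta91 ++ [false, false])),
      86 ≤ (fibRunGraph 91).dist ⟨alpha91, hα⟩ ⟨beta91, hβ⟩ ∧
      86 ≤ (fibRunGraph 91).diam ∧
      (91 : ℤ) - ⌊Real.sqrt (1 + (91 : ℝ) / 2) - 3 / 4⌋ = 85 ∧
      (86 : ℤ) > 85 := by
  have hconn := fibRunGraph_connected 91
  have hdist : 86 ≤ (fibRunGraph 91).dist ⟨alpha91, alpha91_vertex⟩
      ⟨beta91, beta91_vertex⟩ := by
    obtain ⟨p, hp⟩ := hconn.exists_walk_length_eq_dist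
      ⟨alpha91, alpha91_vertex⟩ ⟨beta91, beta91_vertex⟩
    exact hp ▸ alpha91_beta91_walk_length p
  have : Nonempty (FibRunVertex 91) := ⟨⟨alpha91, alpha91_vertex⟩⟩
  have : Finite (FibRunVertex 91) := inferInstance
  refine ⟨alpha91_vertex, beta91_vertex, hdist, ?_, ?_, by norm_num⟩
  · exact hdist.trans (SimpleGraph.dist_le_diam
      (SimpleGraph.connected_iff_ediam_ne_top.mp hconn))
  · rw [floor_sqrt_bound]
    norm_num
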